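/- There exist positive real constants a and b such that for every integer n ≥ 1, the number of isomorphism classes of connected 3-valent 5-arc-transitive graphs of order at most n is at least n^{a·log n} − b (log denotes the natural logarithm). -/

import Mathlib

open SimpleGraph

/-- Finite graphs, presented as graphs on `Fin m` for some `m`. -/
def GSig := Σ m : ℕ, SimpleGraph (Fin m)

/-- Graphs satisfying `P`, up to isomorphism. -/
def graphSetoid (P : GSig → Prop) : Setoid {x : GSig // P x} where
  r a b := Nonempty (a.1.2 ≃g b.1.2)
  iseqv := ⟨fun _ => ⟨RelIso.refl _⟩, fun ⟨e⟩ => ⟨e.symm⟩, fun ⟨e⟩ ⟨f⟩ => ⟨e.trans f⟩⟩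

/-- The number of isomorphism classes of finite graphs satisfying `P`. -/
noncomputable def numIsoClasses (P : GSig → Prop) : ℕ :=
  Nat.card (Quotient (graphSetoid P))

/-- `Γ` is regular of valency `d`. -/
def DValent {V : Type*} (Γ : SimpleGraph V) (d : ℕ) : Prop :=
  ∀ v, (Γ.neighborSet v).ncard = d

/-- An `s`-arc in `Γ`: a sequence of `s+1` vertices in which every two consecutive
vertices are adjacent and every three consecutive vertices are pairwise distinct. -/
def IsSArc {V : Type*} (Γ : SimpleGraph V) (s : ℕ) (f : Fin (s + 1) → V) : Prop :=
  (∀ (i : ℕ) (h : i + 1 ≤ s), Γ.Adj (f ⟨i, by omega⟩) (f ⟨i + 1, by omega⟩)) ∧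
  (∀ (i : ℕ) (h : i + 2 ≤ s),
      f ⟨i, by omega⟩ ≠ f ⟨i + 1, by omega⟩ ∧
      f ⟨i, by omega⟩ ≠ f ⟨i + 2, by omega⟩ ∧
      f ⟨i + 1, by omega⟩ ≠ f ⟨i + 2, by omega⟩)

/-- `Γ` is `s`-arc-transitive: `Aut(Γ)` acts transitively on the `s`-arcs of `Γ`. -/
def IsSArcTransitive {V : Type*} (Γ : SimpleGraph V) (s : ℕ) : Prop :=
  ∀ f g : Fin (s + 1) → V, IsSArc Γ s f → IsSArc Γ s g →
    ∃ φ : Γ ≃g Γ, ∀ i, φ (f i) = g i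

/-- The number of isomorphism classes of connected 3-valent 5-arc-transitive graphs
of order at most `n`. -/
noncomputable def fiveArcCount (n : ℕ) : ℕ :=
  numIsoClasses (fun x => x.1 ≤ n ∧ x.2.Connected ∧ DValent x.2 3 ∧ IsSArcTransitive x.2 5)

section Arcs

variable {V : Type*} {Γ : SimpleGraph V} {s : ℕ}

/-- The first `s + 1` terms of the sequence `f` form an `s`-arc. -/
def IsArcSeq (Γ : SimpleGraph V) (s : ℕ) (f : ℕ → V) : Prop :=
  (∀ i < s, Γ.Adj (f i) (f (i + 1))) ∧ ∀ i, i + 2 ≤ s → f i ≠ f (i + 2)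

theorem isSArc_iff_isArcSeq (f : ℕ → V) :
    IsSArc Γ s (fun i : Fin (s + 1) => f i) ↔ IsArcSeq Γ s f := by
  constructor
  · rintro ⟨h1, h2⟩
    exact ⟨fun i hi => h1 i hi, fun i hi => (h2 i hi).2.1⟩
  · rintro ⟨h1, h2⟩
    exact ⟨fun i hi => h1 i hi, fun i hi =>
      ⟨(h1 i (by omega)).ne, h2 i hi, (h1 (i + 1) (by omega)).ne⟩⟩

theorem isSArcTransitive_iff :
    IsSArcTransitive Γ s ↔ ∀ f g : ℕ → V, IsArcSeq Γ s f → IsArcSeq Γ s g →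
      ∃ φ : Γ ≃g Γ, ∀ i ≤ s, φ (f i) = g i := by
  constructor
  · intro h f g hf hg
    obtain ⟨φ, hφ⟩ := h _ _ ((isSArc_iff_isArcSeq f).2 hf) ((isSArc_iff_isArcSeq g).2 hg)
    exact ⟨φ, fun i hi => hφ ⟨i, by omega⟩⟩
  · intro h f g hf hg
    have key (k : Fin (s + 1) → V) : ∃ k' : ℕ → V, k = fun i : Fin (s + 1) => k' i :=
      ⟨fun j => k ⟨min j s, by omega⟩, funext fun i => congrArg k (Fin.ext (by simp; omega))⟩
    obtain ⟨f, rfl⟩ := key f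
    obtain ⟨g, rfl⟩ := key g
    obtain ⟨φ, hφ⟩ := h f g ((isSArc_iff_isArcSeq f).1 hf) ((isSArc_iff_isArcSeq g).1 hg)
    exact ⟨φ, fun i => hφ i (by omega)⟩

namespace IsArcSeq

theorem reverse {f : ℕ → V} (hf : IsArcSeq Γ s f) : IsArcSeq Γ s (fun i => f (s - i)) := by
  refine ⟨fun i hi => ?_, fun i hi => ?_⟩
  · have := (hf.1 (s - (i + 1)) (by omega)).symm
    rwa [show s - (i + 1) + 1 = s - i by omega] at this
  · have := (hf.2 (s - (i + 2)) (by omega)).symm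
    rwa [show s - (i + 2) + 2 = s - i by omega] at this

theorem mono {f : ℕ → V} {t : ℕ} (hf : IsArcSeq Γ s f) (h : t ≤ s) : IsArcSeq Γ t f :=
  ⟨fun i hi => hf.1 i (by omega), fun i hi => hf.2 i (by omega)⟩

/-- Drop the first vertex of an arc and append `w`. -/
theorem shift {f : ℕ → V} (hf : IsArcSeq Γ s f) {w : V} (hw : Γ.Adj (f s) w)
    (hne : w ≠ f (s - 1)) : IsArcSeq Γ s (fun i => if i < s then f (i + 1) else w) := by
  refine ⟨fun i hi => ?_, fun i hi => ?_⟩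
  · by_cases h : i + 1 < s
    · simpa [hi, h] using hf.1 (i + 1) h
    · have : i + 1 = s := by omega
      simpa [hi, h, this] using hw
  · have h1 : i < s := by omega
    by_cases h : i + 2 < s
    · simpa [h1, h] using hf.2 (i + 1) (by omega)
    · have : i + 1 = s - 1 := by omega
      simpa [h1, h, this] using hne.symm

end IsArcSeq

theorem DValent.exists_adj_ne (h3 : DValent Γ 3) (v u : V) : ∃ w, Γ.Adj v w ∧ w ≠ u := by
  obtain ⟨x, y, z, hxy, -, -, hN⟩ := Set.ncard_eq_three.1 (h3 v)
  have hx : Γ.Adj v x := by change x ∈ Γ.neighborSet v; simp [hN]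
  have hy : Γ.Adj v y := by change y ∈ Γ.neighborSet v; simp [hN]
  by_cases h : x = u
  · exact ⟨y, hy, fun h' => hxy (h.trans h'.symm)⟩
  · exact ⟨x, hx, h⟩

theorem DValent.exists_adj_ne_ne (h3 : DValent Γ 3) (v u u' : V) :
    ∃ w, Γ.Adj v w ∧ w ≠ u ∧ w ≠ u' := by
  obtain ⟨x, y, z, hxy, hxz, hyz, hN⟩ := Set.ncard_eq_three.1 (h3 v)
  have hx : Γ.Adj v x := by change x ∈ Γ.neighborSet v; simp [hN]
  have hy : Γ.Adj v y := by change y ∈ Γ.neighborSet v; simp [hN]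
  have hz : Γ.Adj v z := by change z ∈ Γ.neighborSet v; simp [hN]
  by_contra! hc
  have h1 := hc x hx
  have h2 := hc y hy
  have h4 := hc z hz
  by_cases x = u <;> by_cases y = u <;> by_cases z = u <;> simp_all

theorem DValent.eq_or_eq_or_eq (h3 : DValent Γ 3) {v a b c d : V} (ha : Γ.Adj v a)
    (hb : Γ.Adj v b) (hc : Γ.Adj v c) (hd : Γ.Adj v d) (hab : a ≠ b) (hac : a ≠ c) (hbc : b ≠ c) :
    d = a ∨ d = b ∨ d = c := by
  obtain ⟨x, y, z, hxy, hxz, hyz, hN⟩ := Set.ncard_eq_three.1 (h3 v)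
  have key (e : V) (he : Γ.Adj v e) : e = x ∨ e = y ∨ e = z := by
    have : e ∈ Γ.neighborSet v := he
    simpa [hN] using this
  have h1 := key a ha
  have h2 := key b hb
  have h3 := key c hc
  have h4 := key d hd
  grind

/-- If some automorphism fixes an `s`-arc but not all neighbours of its end point, then
`s`-arc-transitivity implies `(s + 1)`-arc-transitivity. -/
theorem IsSArcTransitive.succ_of_fix (h3 : DValent Γ 3) (hs : 1 ≤ s) (hT : IsSArcTransitive Γ s)
    {f : ℕ → V} (hf : IsArcSeq Γ s f) (φ : Γ ≃g Γ) (hφ : ∀ i ≤ s, φ (f i) = f i) {w : V}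
    (hw : Γ.Adj (f s) w) (hφw : φ w ≠ w) : IsSArcTransitive Γ (s + 1) := by
  rw [isSArcTransitive_iff] at hT ⊢
  have hu : φ (f (s - 1)) = f (s - 1) := hφ _ (by omega)
  have hadj : Γ.Adj (f s) (f (s - 1)) := by
    have := (hf.1 (s - 1) (by omega)).symm
    rwa [show s - 1 + 1 = s by omega] at this
  have hwu : w ≠ f (s - 1) := fun h => hφw (by rw [h, hu])
  have hφwu : φ w ≠ f (s - 1) := fun h => hwu (φ.injective (h.trans hu.symm))
  have hφw_adj : Γ.Adj (f s) (φ w) := by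
    have := φ.map_adj_iff.2 hw
    rwa [hφ s le_rfl] at this
  have key (g : ℕ → V) (hg : IsArcSeq Γ (s + 1) g) :
      ∃ ψ : Γ ≃g Γ, (∀ i ≤ s, ψ (f i) = g i) ∧ ψ w = g (s + 1) := by
    obtain ⟨ψ, hψ⟩ := hT f g hf (hg.mono (by omega))
    have h1 : Γ.Adj (f s) (ψ.symm (g (s + 1))) := by
      rw [← ψ.map_adj_iff, ψ.apply_symm_apply, hψ s le_rfl]
      exact hg.1 s (by omega)
    rcases h3.eq_or_eq_or_eq hadj hw hφw_adj h1 hwu.symm hφwu.symm hφw.symm with h | h | h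
    · have h2 := hg.2 (s - 1) (by omega)
      rw [← hψ (s - 1) (by omega), show s - 1 + 2 = s + 1 by omega, ← h,
        ψ.apply_symm_apply] at h2
      exact absurd rfl h2
    · exact ⟨ψ, hψ, by rw [← h, ψ.apply_symm_apply]⟩
    · refine ⟨φ.trans ψ, fun i hi => ?_, ?_⟩
      · simp [hφ i hi, hψ i hi]
      · simp [← h]
  intro g g' hg hg'
  obtain ⟨ψ, h1, h2⟩ := key g hg
  obtain ⟨ψ', h1', h2'⟩ := key g' hg'
  refine ⟨ψ.symm.trans ψ', fun i hi => ?_⟩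
  rcases Nat.lt_or_ge s i with h | h
  · obtain rfl : i = s + 1 := by omega
    simp [← h2, h2']
  · simp [← h1 i h, h1' i h]

/-- In a connected cubic graph that is `s`-arc-transitive but not `(s + 1)`-arc-transitive, the
pointwise stabiliser of an `s`-arc is trivial. -/
theorem fixes_of_fixes_arc (h3 : DValent Γ 3) (hc : Γ.Connected) (hs : 1 ≤ s)
    (hT : IsSArcTransitive Γ s) (hT' : ¬ IsSArcTransitive Γ (s + 1)) (φ : Γ ≃g Γ)
    {f : ℕ → V} (hf : IsArcSeq Γ s f) (hφ : ∀ i ≤ s, φ (f i) = f i) (v : V) : φ v = v := by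
  let P : (ℕ → V) → Prop := fun g => IsArcSeq Γ s g ∧ ∀ i ≤ s, φ (g i) = g i
  have hfix (g) (hg : P g) (w) (hw : Γ.Adj (g s) w) : φ w = w := by
    by_contra h
    exact hT' (hT.succ_of_fix h3 hs hg.1 φ hg.2 hw h)
  have hrev (g) (hg : P g) : P (fun i => g (s - i)) :=
    ⟨hg.1.reverse, fun i _ => hg.2 _ (by omega)⟩
  have hshift (g) (hg : P g) (w) (hw : Γ.Adj (g s) w) (hne : w ≠ g (s - 1)) :
      P (fun i => if i < s then g (i + 1) else w) := by
    refine ⟨hg.1.shift hw hne, fun i hi => ?_⟩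
    by_cases h : i < s
    · simpa [h] using hg.2 (i + 1) (by omega)
    · simpa [h] using hfix g hg w hw
  have hend (u w : V) (huw : Γ.Adj u w) (hu : ∃ g, P g ∧ g s = u) : ∃ g, P g ∧ g s = w := by
    obtain ⟨g, hg, rfl⟩ := hu
    by_cases hne : w = g (s - 1)
    · obtain ⟨x, hx, hxne⟩ := h3.exists_adj_ne (g 0) (g 1)
      have h1 := hshift _ (hrev g hg) x (by simpa using hx)
        (by simpa [show s - (s - 1) = 1 by omega] using hxne)
      refine ⟨_, hrev _ h1, ?_⟩
      have : 0 < s := hs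
      simp [this, hne]
    · exact ⟨_, hshift g hg w huw hne, by simp⟩
  have hall : ∃ g, P g ∧ g s = v := by
    have hr := hc.preconnected (f s) v
    rw [SimpleGraph.reachable_iff_reflTransGen] at hr
    induction hr with
    | refl => exact ⟨f, ⟨hf, hφ⟩, rfl⟩
    | tail _ hbc ih => exact hend _ _ hbc ih
  obtain ⟨g, hg, rfl⟩ := hall
  exact hg.2 s le_rfl

theorem not_isSArcTransitive_of_closed (h3 : DValent Γ 3) (hs : 2 ≤ s) {h : ℕ → V}
    (hh : IsArcSeq Γ s h) (hcl : h 0 = h s) : ¬ IsSArcTransitive Γ s := by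
  rw [isSArcTransitive_iff]
  intro hT
  obtain ⟨w, hw, hw1, hw2⟩ := h3.exists_adj_ne_ne (h (s - 1)) (h (s - 2)) (h s)
  have hg : IsArcSeq Γ s (fun i => if i < s then h i else w) := by
    refine ⟨fun i hi => ?_, fun i hi => ?_⟩
    · by_cases h' : i + 1 < s
      · simpa [hi, h'] using hh.1 i hi
      · have : i = s - 1 := by omega
        subst this
        simpa [hi, h'] using hw
    · have h1 : i < s := by omega
      by_cases h' : i + 2 < s
      · simpa [h1, h'] using hh.2 i hi
      · have : i = s - 2 := by omega
        subst this
        simpa [h1, h'] using hw1.symm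
  obtain ⟨φ, hφ⟩ := hT _ _ hh hg
  have h0 := hφ 0 (by omega)
  have h1 := hφ s le_rfl
  have hs0 : 0 < s := by omega
  simp only [lt_irrefl, if_false, if_pos hs0] at h0 h1
  exact hw2 (by rw [← h1, ← hcl, h0])

/-- A connected cubic arc-transitive graph with a closed arc of length `L` has at most `|V| ^ L`
automorphisms. -/
theorem card_aut_le [Finite V] (h3 : DValent Γ 3) (hc : Γ.Connected) {L : ℕ} (hs : 1 ≤ s)
    (hsL : s < L) (hT : IsSArcTransitive Γ s) {h : ℕ → V} (hh : IsArcSeq Γ L h)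
    (hcl : h 0 = h L) : Nat.card (Γ ≃g Γ) ≤ Nat.card V ^ L := by
  have hL := not_isSArcTransitive_of_closed h3 (by omega) hh hcl
  obtain ⟨t, ht, htL, hTt, hTt'⟩ : ∃ t, 1 ≤ t ∧ t < L ∧ IsSArcTransitive Γ t ∧
      ¬ IsSArcTransitive Γ (t + 1) := by
    by_contra! hcon
    have hall (k : ℕ) : s + k ≤ L → IsSArcTransitive Γ (s + k) := by
      induction k with
      | zero => exact fun _ => hT
      | succ k ih => exact fun hk => hcon (s + k) (by omega) (by omega) (ih (by omega))
    have := hall (L - s) (by omega)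
    rw [show s + (L - s) = L by omega] at this
    exact hL this
  have hinj : Function.Injective (fun (φ : Γ ≃g Γ) (i : Fin L) => φ (h i)) := by
    intro φ ψ hφψ
    ext v
    have := fixes_of_fixes_arc h3 hc ht hTt hTt' (φ.trans ψ.symm) (hh.mono htL.le)
      (fun i hi => by
        have := congrFun hφψ ⟨i, by omega⟩
        simp only at this
        simp [this]) v
    simpa [RelIso.symm_apply_eq] using this
  have := Nat.card_le_card_of_injective _ hinj
  simpa [Nat.card_fun] using this

end Arcs

section Restrict

variable {W : Type*} {Y : SimpleGraph W}

/-- Automorphisms of `Y` preserving the connected component `C`. -/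
def componentStabilizer (C : Y.ConnectedComponent) : Subgroup (Y ≃g Y) where
  carrier := {ψ | ∀ y, ψ y ∈ C.supp ↔ y ∈ C.supp}
  mul_mem' {a b} ha hb y := (ha (b y)).trans (hb y)
  one_mem' y := Iff.rfl
  inv_mem' {a} ha y := by
    have := ha (a⁻¹ y)
    rw [show a (a⁻¹ y) = y from a.apply_symm_apply y] at this
    exact this.symm

theorem mem_componentStabilizer {C : Y.ConnectedComponent} {ψ : Y ≃g Y} {y : W}
    (hy : y ∈ C.supp) (hψ : ψ y ∈ C.supp) : ψ ∈ componentStabilizer C := by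
  intro z
  rw [SimpleGraph.ConnectedComponent.mem_supp_iff] at hy hψ ⊢
  rw [SimpleGraph.ConnectedComponent.mem_supp_iff, ← hψ]
  rw [SimpleGraph.ConnectedComponent.eq, ψ.reachable_iff, hψ, ← hy,
    SimpleGraph.ConnectedComponent.eq]

/-- Restriction of automorphisms to a connected component. -/
def restrictComponent (C : Y.ConnectedComponent) :
    componentStabilizer C →* (C.toSimpleGraph ≃g C.toSimpleGraph) where
  toFun ψ :=
    { toFun := fun y => ⟨ψ.1 y.1, (ψ.2 y.1).2 y.2⟩
      invFun := fun y => ⟨ψ.1⁻¹ y.1, (ψ⁻¹.2 y.1).2 y.2⟩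
      left_inv := fun y => Subtype.ext (ψ.1.symm_apply_apply y.1)
      right_inv := fun y => Subtype.ext (ψ.1.apply_symm_apply y.1)
      map_rel_iff' := ψ.1.map_adj_iff }
  map_one' := rfl
  map_mul' _ _ := rfl

theorem DValent.toSimpleGraph {d : ℕ} (h : DValent Y d) (C : Y.ConnectedComponent) :
    DValent C.toSimpleGraph d := by
  intro v
  rw [← h v.1, ← Set.ncard_image_of_injective _ Subtype.val_injective]
  congr 1
  ext w
  constructor
  · rintro ⟨w, hw, rfl⟩
    exact hw
  · intro hw
    exact ⟨⟨w, C.mem_supp_of_adj_mem_supp v.2 hw⟩, hw, rfl⟩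

end Restrict

section VoltageCover

variable {V H : Type*} [Group H] {B : SimpleGraph V} {ζ : V → V → H}

/-- The derived graph of a voltage assignment `ζ` on the arcs of `B`. -/
def voltageCover (B : SimpleGraph V) (ζ : V → V → H)
    (hζ : ∀ u v, B.Adj u v → ζ v u = (ζ u v)⁻¹) : SimpleGraph (V × H) where
  Adj p q := B.Adj p.1 q.1 ∧ q.2 = p.2 * ζ p.1 q.1
  symm := ⟨fun p q ⟨h1, h2⟩ => ⟨h1.symm, by rw [hζ _ _ h1, h2, mul_inv_cancel_right]⟩⟩
  loopless := ⟨fun _ h => B.loopless.irrefl _ h.1⟩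

variable {hζ : ∀ u v, B.Adj u v → ζ v u = (ζ u v)⁻¹}

/-- The action of the voltage group by covering transformations. -/
def deck (hζ : ∀ u v, B.Adj u v → ζ v u = (ζ u v)⁻¹) :
    H →* (voltageCover B ζ hζ ≃g voltageCover B ζ hζ) where
  toFun h :=
    { toEquiv := (Equiv.refl V).prodCongr (Equiv.mulLeft h)
      map_rel_iff' := by simp [voltageCover, mul_assoc] }
  map_one' := RelIso.ext fun x => Prod.ext rfl (one_mul x.2)
  map_mul' a b := RelIso.ext fun x => Prod.ext rfl (mul_assoc a b x.2)

/-- The lift of a voltage-preserving automorphism of the base graph. -/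
def liftAut (φ : B ≃g B) (θ : H ≃* H)
    (hθ : ∀ u v, B.Adj u v → θ (ζ u v) = ζ (φ u) (φ v)) :
    voltageCover B ζ hζ ≃g voltageCover B ζ hζ where
  toEquiv := φ.toEquiv.prodCongr θ.toEquiv
  map_rel_iff' {a b} := by
    simp only [voltageCover, Equiv.prodCongr_apply, Prod.map]
    constructor
    · rintro ⟨h1, h2⟩
      have h1' : B.Adj a.1 b.1 := φ.map_adj_iff.1 h1
      refine ⟨h1', θ.injective ?_⟩
      rw [map_mul, hθ _ _ h1']
      exact h2
    · rintro ⟨h1, h2⟩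
      refine ⟨φ.map_adj_iff.2 h1, ?_⟩
      change θ b.2 = θ a.2 * ζ (φ a.1) (φ b.1)
      rw [h2, map_mul, hθ _ _ h1]

theorem dValent_voltageCover {d : ℕ} (h : DValent B d) : DValent (voltageCover B ζ hζ) d := by
  intro v
  have hinj : Function.Injective (fun w => ((w, v.2 * ζ v.1 w) : V × H)) :=
    fun a b hab => congrArg Prod.fst hab
  rw [← h v.1, ← Set.ncard_image_of_injective _ hinj]
  congr 1
  ext ⟨w, k⟩
  constructor
  · rintro ⟨h1, h2⟩
    exact ⟨w, h1, by simpa using h2.symm⟩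
  · rintro ⟨w', hw', he⟩
    obtain ⟨rfl, rfl⟩ := Prod.ext_iff.1 he
    exact ⟨hw', rfl⟩

/-- If all automorphisms of the base graph lift, then `s`-arc-transitivity lifts to the components
of the derived graph. -/
theorem isSArcTransitive_voltageCover {s : ℕ} (hT : IsSArcTransitive B s)
    (hlift : ∀ φ : B ≃g B, ∃ θ : H ≃* H, ∀ u v, B.Adj u v → θ (ζ u v) = ζ (φ u) (φ v))
    (C : (voltageCover B ζ hζ).ConnectedComponent) : IsSArcTransitive C.toSimpleGraph s := by
  rw [isSArcTransitive_iff] at hT ⊢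
  intro f g hf hg
  have hproj (k : ℕ → C) (hk : IsArcSeq C.toSimpleGraph s k) :
      IsArcSeq B s (fun i => (k i).1.1) := by
    refine ⟨fun i hi => (hk.1 i hi).1, fun i hi heq => hk.2 i hi ?_⟩
    have h1 : (voltageCover B ζ hζ).Adj (k (i + 1)).1 (k i).1 :=
      (hk.1 i (by omega)).symm
    have h2 : (voltageCover B ζ hζ).Adj (k (i + 1)).1 (k (i + 1 + 1)).1 :=
      hk.1 (i + 1) (by omega)
    refine Subtype.ext (Prod.ext heq ?_)
    rw [h1.2, h2.2]
    exact congrArg (fun x => (k (i + 1)).1.2 * ζ (k (i + 1)).1.1 x) heq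
  obtain ⟨φ, hφ⟩ := hT _ _ (hproj f hf) (hproj g hg)
  obtain ⟨θ, hθ⟩ := hlift φ
  set d : H := (g 0).1.2 * (θ (f 0).1.2)⁻¹ with hd
  set ψ : voltageCover B ζ hζ ≃g voltageCover B ζ hζ :=
    (liftAut φ θ hθ).trans (deck hζ d) with hψ
  have hψ_apply (y : V × H) : ψ y = (φ y.1, d * θ y.2) := rfl
  have key : ∀ i ≤ s, ψ (f i).1 = (g i).1 := by
    intro i
    induction i with
    | zero =>
      intro _
      exact Prod.ext (hφ 0 (Nat.zero_le _)) (by simp [hψ_apply, hd])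
    | succ i ih =>
      intro hi
      have h0 := ih (by omega)
      have h1 : (voltageCover B ζ hζ).Adj (f i).1 (f (i + 1)).1 := hf.1 i (by omega)
      have h2 : (voltageCover B ζ hζ).Adj (g i).1 (g (i + 1)).1 := hg.1 i (by omega)
      have h3 := ψ.map_adj_iff.2 h1
      have h4 : (ψ (f (i + 1)).1).1 = (g (i + 1)).1.1 := hφ _ hi
      refine Prod.ext h4 ?_
      rw [h3.2, h2.2, h0, h4]
  have hmem : ψ ∈ componentStabilizer C :=
    mem_componentStabilizer (f 0).2 (by rw [key 0 (Nat.zero_le _)]; exact (g 0).2)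
  exact ⟨restrictComponent C ⟨ψ, hmem⟩, fun i hi => Subtype.ext (key i hi)⟩

/-- The total voltage of a list of arcs. -/
def arcProd (ζ : V → V → H) (l : List (V × V)) : H := (l.map fun a => ζ a.1 a.2).prod

/-- The list of reversed arcs, in reverse order. -/
def arcReverse (l : List (V × V)) : List (V × V) := (l.map Prod.swap).reverse

/-- The start vertex of the `k`-th arc of a closed walk at `v`. -/
def arcStart (v : V) (l : List (V × V)) (k : ℕ) : V := (l.getD k (v, v)).1

/-- `l` lists the arcs of a closed walk in `B` based at `v`. -/
def IsClosedArcList (B : SimpleGraph V) (v : V) (l : List (V × V)) : Prop :=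
  arcStart v l 0 = v ∧ ∀ k < l.length, l.getD k (v, v) = (arcStart v l k, arcStart v l (k + 1)) ∧
    B.Adj (arcStart v l k) (arcStart v l (k + 1))

theorem arcProd_append (l l' : List (V × V)) :
    arcProd ζ (l ++ l') = arcProd ζ l * arcProd ζ l' := by simp [arcProd]

theorem arcProd_arcReverse (hζ' : ∀ u v, ζ v u = (ζ u v)⁻¹) (l : List (V × V)) :
    arcProd ζ (arcReverse l) = (arcProd ζ l)⁻¹ := by
  have h : (fun a : V × V => ζ a.2 a.1) = fun a => (ζ a.1 a.2)⁻¹ :=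
    funext fun a => hζ' a.1 a.2
  simp [arcProd, arcReverse, List.prod_inv_reverse, Function.comp_def, h]

theorem arcProd_take_succ {v : V} {l : List (V × V)} (hl : IsClosedArcList B v l) {k : ℕ}
    (hk : k < l.length) : arcProd ζ (l.take (k + 1)) =
      arcProd ζ (l.take k) * ζ (arcStart v l k) (arcStart v l (k + 1)) := by
  have h := (hl.2 k hk).1
  rw [List.getD_eq_getElem _ _ hk] at h
  rw [List.take_succ_eq_append_getElem hk, arcProd_append, h]
  simp [arcProd]

theorem voltageCover_adj_lift {v : V} {l : List (V × V)} (hl : IsClosedArcList B v l) {k : ℕ}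
    (hk : k < l.length) : (voltageCover B ζ hζ).Adj (arcStart v l k, arcProd ζ (l.take k))
      (arcStart v l (k + 1), arcProd ζ (l.take (k + 1))) :=
  ⟨(hl.2 k hk).2, arcProd_take_succ hl hk⟩

theorem arcStart_length (v : V) (l : List (V × V)) : arcStart v l l.length = v := by
  simp [arcStart]

theorem reachable_lift {v : V} {l : List (V × V)} (hl : IsClosedArcList B v l) (k : ℕ)
    (hk : k ≤ l.length) : (voltageCover B ζ hζ).Reachable (v, 1)
      (arcStart v l k, arcProd ζ (l.take k)) := by
  induction k with
  | zero => simp [hl.1, arcProd]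
  | succ k ih => exact (ih (by omega)).trans (voltageCover_adj_lift hl (by omega)).reachable

/-- The voltages of closed walks at `v` act on the component of `(v, 1)`. -/
theorem deck_mem_componentStabilizer {v : V} {l : List (V × V)} (hl : IsClosedArcList B v l) :
    deck hζ (arcProd ζ l) ∈
      componentStabilizer ((voltageCover B ζ hζ).connectedComponentMk (v, 1)) := by
  refine mem_componentStabilizer (y := (v, 1)) rfl ?_
  have h := reachable_lift (hζ := hζ) hl l.length le_rfl
  rw [arcStart_length, List.take_length] at h
  rw [SimpleGraph.ConnectedComponent.mem_supp_iff, SimpleGraph.ConnectedComponent.eq]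
  have h' : deck hζ (arcProd ζ l) (v, 1) = (v, arcProd ζ l) := Prod.ext rfl (mul_one _)
  rw [h']
  exact h.symm

/-- The subgroup of voltages preserving the component of `(v, 1)`. -/
def componentVoltages (hζ : ∀ u v, B.Adj u v → ζ v u = (ζ u v)⁻¹) (v : V) : Subgroup H :=
  (componentStabilizer ((voltageCover B ζ hζ).connectedComponentMk (v, 1))).comap (deck hζ)

/-- The action of `componentVoltages` on the component of `(v, 1)`. -/
def componentDeck (hζ : ∀ u v, B.Adj u v → ζ v u = (ζ u v)⁻¹) (v : V) :
    componentVoltages hζ v →*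
      (((voltageCover B ζ hζ).connectedComponentMk (v, 1)).toSimpleGraph ≃g
        ((voltageCover B ζ hζ).connectedComponentMk (v, 1)).toSimpleGraph) :=
  (restrictComponent _).comp ((deck hζ).subgroupComap _)

theorem componentDeck_injective (v : V) : Function.Injective (componentDeck hζ v) := by
  rw [injective_iff_map_eq_one]
  intro h hh
  have h1 := congrArg (fun e => (e ⟨(v, 1), rfl⟩).1.2) hh
  have h2 : h.1 * 1 = (1 : H) := h1
  exact Subtype.ext (by simpa using h2)

/-- A closed walk without backtracking and with trivial voltage lifts to a closed arc. -/
theorem exists_closed_arc {v : V} {l : List (V × V)} (hl : IsClosedArcList B v l)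
    (hnb : ∀ k, k + 2 ≤ l.length → arcStart v l k ≠ arcStart v l (k + 2))
    (h1 : arcProd ζ l = 1) :
    ∃ h : ℕ → ((voltageCover B ζ hζ).connectedComponentMk (v, 1)),
      IsArcSeq ((voltageCover B ζ hζ).connectedComponentMk (v, 1)).toSimpleGraph l.length h ∧
        h 0 = h l.length := by
  have hmem (k : ℕ) (hk : k ≤ l.length) : (arcStart v l k, arcProd ζ (l.take k)) ∈
      ((voltageCover B ζ hζ).connectedComponentMk (v, 1)).supp := by
    rw [SimpleGraph.ConnectedComponent.mem_supp_iff, SimpleGraph.ConnectedComponent.eq]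
    exact (reachable_lift hl k hk).symm
  refine ⟨fun k => ⟨_, hmem (min k l.length) (min_le_right _ _)⟩,
    ⟨fun k hk => ?_, fun k hk => ?_⟩, ?_⟩
  · have h := voltageCover_adj_lift (hζ := hζ) hl hk
    change (voltageCover B ζ hζ).Adj (_, _) (_, _)
    rwa [min_eq_left (by omega : k ≤ l.length), min_eq_left (by omega : k + 1 ≤ l.length)]
  · intro h
    have h' := congrArg (fun y => y.1.1) h
    simp only at h'
    rw [min_eq_left (by omega : k ≤ l.length), min_eq_left (by omega : k + 2 ≤ l.length)] at h'
    exact hnb k hk h'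
  · refine Subtype.ext ?_
    simp only [Nat.zero_min, min_self, List.take_zero, List.take_length, h1, hl.1,
      arcStart_length]
    rfl

end VoltageCover

section SymmetrizedVoltage

variable {V K : Type*} [DecidableEq V] [Group K]

/-- The voltage assignment with value `t` on the arc `a`, value `x` on the arc `a'`, and trivial
elsewhere. -/
def pairVoltage (t x : K) (a a' : V × V) (u v : V) : K :=
  if u = v then 1 else if (u, v) = a then t else if (v, u) = a then t⁻¹
  else if (u, v) = a' then x else if (v, u) = a' then x⁻¹ else 1

theorem pairVoltage_swap (t x : K) (a a' : V × V) (u v : V) :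
    pairVoltage t x a a' v u = (pairVoltage t x a a' u v)⁻¹ := by
  unfold pairVoltage
  by_cases h : u = v
  · simp [h]
  · have h' : v ≠ u := Ne.symm h
    have h1 : (u, v) = a → (v, u) ≠ a := by rintro rfl h2; exact h (Prod.ext_iff.1 h2).2
    have h2 : (u, v) = a' → (v, u) ≠ a' := by rintro rfl h2; exact h (Prod.ext_iff.1 h2).2
    rw [if_neg h, if_neg h']
    split_ifs <;> simp_all

/-- The number of times the list of arcs `l` traverses `a`, counted with sign. -/
def arcExponent (a : V × V) (l : List (V × V)) : ℤ := l.count a - l.count a.swap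

/-- The list of arcs `l` contains `a` or its reverse. -/
def Touches (a : V × V) (l : List (V × V)) : Prop := a ∈ l ∨ a.swap ∈ l

theorem arcExponent_eq_zero {a : V × V} {l : List (V × V)} (h : ¬ Touches a l) :
    arcExponent a l = 0 := by
  simp only [Touches, not_or] at h
  simp [arcExponent, List.count_eq_zero_of_not_mem, h.1, h.2]

theorem arcProd_pairVoltage_left (t x : K) (a a' : V × V) (l : List (V × V))
    (h : ¬ Touches a' l) : arcProd (pairVoltage t x a a') l = t ^ arcExponent a l := by
  induction l with
  | nil => simp [arcProd, arcExponent]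
  | cons c l ih =>
    simp only [Touches, List.mem_cons, not_or] at h
    obtain ⟨⟨h1, h2⟩, h3, h4⟩ := h
    have ih' := ih (by simp [Touches, h2, h4])
    obtain ⟨u, v⟩ := c
    have h5 : (v, u) ≠ a' := fun h => h3 (by rw [← h]; rfl)
    have e1 : arcExponent a ((u, v) :: l) = (if (u, v) = a then 1 else 0) -
        (if (v, u) = a then 1 else 0) + arcExponent a l := by
      have h6 : ((u, v) == a.swap) = ((v, u) == a) := by
        rcases a with ⟨p, q⟩
        simp [Prod.ext_iff, and_comm, Bool.beq_eq_decide_eq, -Prod.mk.injEq]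
      simp only [arcExponent, List.count_cons, h6, beq_iff_eq]
      split_ifs <;> push_cast <;> ring
    have e2 : arcProd (pairVoltage t x a a') ((u, v) :: l) =
        pairVoltage t x a a' u v * arcProd (pairVoltage t x a a') l := by simp [arcProd]
    rw [e1, e2, ih', zpow_add]
    congr 1
    unfold pairVoltage
    by_cases h : u = v
    · subst h; simp
    · have h6 : (u, v) = a → (v, u) ≠ a := by rintro rfl h2; exact h (Prod.ext_iff.1 h2).2
      rw [if_neg h]
      by_cases h7 : (u, v) = a
      · simp [h7, h6 h7]
      · by_cases h8 : (v, u) = a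
        · simp [h7, h8]
        · simp [h7, h8, Ne.symm h1, h5]

theorem arcProd_pairVoltage_right (t x : K) (a a' : V × V) (l : List (V × V))
    (h : ¬ Touches a l) : arcProd (pairVoltage t x a a') l = x ^ arcExponent a' l := by
  rw [← arcProd_pairVoltage_left x t a' a l h]
  unfold arcProd
  congr 1
  refine List.map_congr_left fun c hc => ?_
  obtain ⟨u, v⟩ := c
  have h1 : (u, v) ≠ a := fun h' => h (Or.inl (h' ▸ hc))
  have h2 : (v, u) ≠ a := fun h' => h (Or.inr (h' ▸ hc))
  simp only [pairVoltage, h1, h2, if_false]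

/-- The voltage assignment whose coordinates are all the assignments `pairVoltage t x a a'`. -/
def symVoltage (t x : K) (u v : V) : (V × V) × (V × V) → K :=
  fun i => pairVoltage t x i.1 i.2 u v

theorem symVoltage_swap (t x : K) (u v : V) :
    symVoltage t x v u = (symVoltage t x u v)⁻¹ :=
  funext fun i => pairVoltage_swap t x i.1 i.2 u v

theorem arcProd_symVoltage (t x : K) (l : List (V × V)) (i : (V × V) × (V × V)) :
    arcProd (symVoltage t x) l i = arcProd (pairVoltage t x i.1 i.2) l := by
  simp [arcProd, Pi.list_prod_apply, Function.comp_def, symVoltage]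

theorem exists_symVoltage_equiv (t x : K) (φ : V ≃ V) :
    ∃ θ : ((V × V) × (V × V) → K) ≃* ((V × V) × (V × V) → K),
      ∀ u v, θ (symVoltage t x u v) = symVoltage t x (φ u) (φ v) := by
  refine ⟨MulEquiv.arrowCongr ((φ.prodCongr φ).prodCongr (φ.prodCongr φ)) (MulEquiv.refl K),
    fun u v => funext fun ⟨⟨a, b⟩, ⟨c, d⟩⟩ => ?_⟩
  simp [symVoltage, pairVoltage, Equiv.eq_symm_apply]

/-- The relevant behaviour of the coordinates of the voltages of two closed walks. -/
def IsCoordinate (t x T X : K) : Prop :=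
  T = 1 ∨ X = 1 ∨ (T = t ∧ X = x) ∨ (T = t⁻¹ ∧ X = x) ∨ T ^ 2 = 1

theorem isCoordinate_arcProd (t x : K) (hx : x ^ 2 = 1) {c c' : List (V × V)}
    (hdisj : ∀ a, ¬ (Touches a c ∧ Touches a c'))
    (hexp : ∀ a, arcExponent a c = 0 ∨ arcExponent a c = 1 ∨ arcExponent a c = -1)
    (i : (V × V) × (V × V)) :
    IsCoordinate t x (arcProd (symVoltage t x) c i) (arcProd (symVoltage t x) c' i) := by
  obtain ⟨a, a'⟩ := i
  have hx2 (n : ℤ) : x ^ n = 1 ∨ x ^ n = x := by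
    have hx2' : x ^ (2 : ℤ) = 1 := by exact_mod_cast hx
    rcases Int.even_or_odd' n with ⟨k, rfl | rfl⟩
    · left; rw [zpow_mul, hx2', one_zpow]
    · right; rw [zpow_add, zpow_mul, hx2', one_zpow, one_mul, zpow_one]
  simp only [arcProd_symVoltage, IsCoordinate]
  by_cases h1 : Touches a c
  · have h2 : ¬ Touches a c' := fun h => hdisj a ⟨h1, h⟩
    rw [arcProd_pairVoltage_right t x a a' c' h2]
    by_cases h3 : Touches a' c'
    · have h4 : ¬ Touches a' c := fun h => hdisj a' ⟨h, h3⟩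
      rw [arcProd_pairVoltage_left t x a a' c h4]
      rcases hexp a with h | h | h <;> rw [h] <;> rcases hx2 (arcExponent a' c') with h' | h' <;>
        simp [h']
    · rw [arcExponent_eq_zero h3]
      simp
  · rw [arcProd_pairVoltage_right t x a a' c h1]
    refine Or.inr (Or.inr (Or.inr (Or.inr ?_)))
    rcases hx2 (arcExponent a' c) with h' | h' <;> simp [h', hx]

end SymmetrizedVoltage

section CommutatorWords

/-- The commutator of `B` with its conjugate by `A ^ (2 * n)`. -/
def commWord {G : Type*} [Group G] (A B : G) (n : ℕ) : G :=
  A ^ (2 * n) * B * (A ^ (2 * n))⁻¹ * B * (A ^ (2 * n) * B * (A ^ (2 * n))⁻¹)⁻¹ * B⁻¹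

/-- The words `commWord A B n` for `D < n ≤ 2 * D` are expressed through those with `n ≤ D`
by the matrix `M`. -/
def MatrixRelation {G : Type*} [Group G] {D : ℕ} (M : Fin D → Fin D → ZMod 2) (A B : G) : Prop :=
  ∀ k : Fin D, commWord A B (D + k + 1) =
    ((List.finRange D).map fun i : Fin D => commWord A B (i + 1) ^ (M k i).val).prod

variable {G G' : Type*} [Group G] [Group G']

theorem map_commWord (f : G →* G') (A B : G) (n : ℕ) :
    f (commWord A B n) = commWord (f A) (f B) n := by
  simp [commWord]

theorem matrixRelation_map_iff (f : G →* G') (hf : Function.Injective f) {D : ℕ}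
    (M : Fin D → Fin D → ZMod 2) (A B : G) :
    MatrixRelation M (f A) (f B) ↔ MatrixRelation M A B := by
  refine forall_congr' fun k => ?_
  rw [← hf.eq_iff (a := commWord A B (D + k + 1)), map_list_prod]
  simp [← map_commWord, Function.comp_def]

theorem matrixRelation_pi_iff {I : Type*} {D : ℕ} (M : Fin D → Fin D → ZMod 2) (A B : I → G) :
    MatrixRelation M A B ↔ ∀ i, MatrixRelation M (A i) (B i) := by
  unfold MatrixRelation
  rw [forall_comm]
  refine forall_congr' fun k => ?_
  rw [funext_iff]
  refine forall_congr' fun i => ?_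
  have h (n : ℕ) : commWord A B n i = commWord (A i) (B i) n :=
    map_commWord (Pi.evalMonoidHom (fun _ : I => G) i) A B n
  simp [h, Pi.list_prod_apply, Function.comp_def]

theorem matrixRelation_of_commWord_eq_one {D : ℕ} (M : Fin D → Fin D → ZMod 2) {A B : G}
    (h : ∀ n, commWord A B n = 1) : MatrixRelation M A B := by
  intro k
  simp [h]

theorem commWord_eq_one {A B : G} (h : A = 1 ∨ B = 1 ∨ A ^ 2 = 1) (n : ℕ) :
    commWord A B n = 1 := by
  rcases h with rfl | rfl | h
  · simp [commWord]
  · simp [commWord]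
  · simp [commWord, pow_mul, h]

end CommutatorWords

section HeisenbergShift

variable {D : ℕ}

/-- The modulus of the shift used for `D × D` matrices. -/
abbrev shiftModulus (D : ℕ) : ℕ := 8 * D + 1

/-- The commutator values: the standard basis vectors followed by the rows of `M`. -/
def commValue (M : Fin D → Fin D → ZMod 2) (n : ℕ) : Fin D → ZMod 2 :=
  fun i => if n = i + 1 then 1 else if h : D < n ∧ n ≤ 2 * D then M ⟨n - D - 1, by omega⟩ i else 0

/-- The structure constants of the bilinear form. -/
def shiftForm (M : Fin D → Fin D → ZMod 2) (c : ZMod (shiftModulus D)) : Fin D → ZMod 2 :=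
  if c.val % 2 = 0 ∧ c.val ≤ 4 * D then commValue M (c.val / 2) else 0

/-- An extension by a cyclic shift of a group of nilpotency class two determined by `M`. -/
@[ext]
structure ShiftGroup (M : Fin D → Fin D → ZMod 2) where
  /-- The shift. -/
  shift : ZMod (shiftModulus D)
  /-- The coordinates of the elementary abelian quotient. -/
  coord : ZMod (shiftModulus D) → ZMod 2
  /-- The central part. -/
  central : Fin D → ZMod 2

namespace ShiftGroup

variable {M : Fin D → Fin D → ZMod 2}

/-- The shift-invariant bilinear form with structure constants `shiftForm M`. -/
def form (M : Fin D → Fin D → ZMod 2) (f g : ZMod (shiftModulus D) → ZMod 2) : Fin D → ZMod 2 :=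
  ∑ u, ∑ v, (f u * g v) • shiftForm M (v - u)

theorem form_add_left (f f' g) : form M (f + f') g = form M f g + form M f' g := by
  simp [form, add_mul, add_smul, Finset.sum_add_distrib]

theorem form_add_right (f g g') : form M f (g + g') = form M f g + form M f g' := by
  simp [form, mul_add, add_smul, Finset.sum_add_distrib]

theorem form_zero_left (g) : form M 0 g = 0 := by simp [form]

theorem form_zero_right (f) : form M f 0 = 0 := by simp [form]

theorem form_shift (i : ZMod (shiftModulus D)) (f g) :
    form M (fun u => f (u - i)) (fun u => g (u - i)) = form M f g := by
  unfold form
  rw [← Equiv.sum_comp (Equiv.addRight i)]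
  refine Finset.sum_congr rfl fun u _ => ?_
  rw [← Equiv.sum_comp (Equiv.addRight i)]
  simp

theorem form_single (i j : ZMod (shiftModulus D)) :
    form M (Pi.single i 1) (Pi.single j 1) = shiftForm M (j - i) := by
  unfold form
  rw [Finset.sum_eq_single i, Finset.sum_eq_single j]
  · simp
  · intro b _ hb; simp [hb]
  · simp
  · intro b _ hb; simp [hb]
  · simp

instance : Mul (ShiftGroup M) :=
  ⟨fun p q => ⟨p.shift + q.shift, p.coord + fun u => q.coord (u - p.shift),
    p.central + q.central + form M p.coord (fun u => q.coord (u - p.shift))⟩⟩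

instance : One (ShiftGroup M) := ⟨⟨0, 0, 0⟩⟩

instance : Inv (ShiftGroup M) :=
  ⟨fun p => ⟨-p.shift, fun u => p.coord (u + p.shift), p.central + form M p.coord p.coord⟩⟩

theorem mul_def (p q : ShiftGroup M) : p * q = ⟨p.shift + q.shift,
    p.coord + fun u => q.coord (u - p.shift),
    p.central + q.central + form M p.coord (fun u => q.coord (u - p.shift))⟩ := rfl

theorem one_def : (1 : ShiftGroup M) = ⟨0, 0, 0⟩ := rfl

theorem inv_def (p : ShiftGroup M) : p⁻¹ = ⟨-p.shift, fun u => p.coord (u + p.shift),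
    p.central + form M p.coord p.coord⟩ := rfl

instance : Group (ShiftGroup M) := Group.ofLeftAxioms
  (by
    intro p q r
    obtain ⟨g, hg⟩ : ∃ g : ZMod (shiftModulus D) → ZMod 2, g = fun w => r.coord (w - q.shift) :=
      ⟨_, rfl⟩
    have h : (fun u => (q.coord + g) (u - p.shift)) =
        (fun u => q.coord (u - p.shift)) + fun u => g (u - p.shift) := rfl
    have h' : (fun u => r.coord (u - (p.shift + q.shift))) = fun u => g (u - p.shift) := by
      funext u; simp only [hg, sub_sub]
    have h'' := form_shift (M := M) p.shift q.coord g
    simp only [mul_def, ← hg]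
    rw [h', h, form_add_left, form_add_right, h'']
    refine ShiftGroup.ext (add_assoc _ _ _) (add_assoc _ _ _) ?_
    simp only
    abel)
  (by
    intro p
    simp only [mul_def, one_def]
    refine ShiftGroup.ext (by simp) (by simp) ?_
    simp [form_zero_left])
  (by
    intro p
    simp only [mul_def, one_def, inv_def, sub_neg_eq_add]
    have h : form M (fun u => p.coord (u + p.shift)) (fun u => p.coord (u + p.shift)) =
        form M p.coord p.coord := by
      simpa [sub_neg_eq_add] using form_shift (M := M) (-p.shift) p.coord p.coord
    refine ShiftGroup.ext (by simp) (funext fun _ => CharTwo.add_self_eq_zero _) ?_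
    simp only
    rw [h, show p.central + form M p.coord p.coord + p.central + form M p.coord p.coord =
      (p.central + form M p.coord p.coord) + (p.central + form M p.coord p.coord) by abel]
    exact funext fun i => CharTwo.add_self_eq_zero ((p.central + form M p.coord p.coord) i))

/-- The shift element. -/
def t (M : Fin D → Fin D → ZMod 2) : ShiftGroup M := ⟨1, 0, 0⟩

/-- The basis element at `n`. -/
def x (M : Fin D → Fin D → ZMod 2) (n : ZMod (shiftModulus D)) : ShiftGroup M :=
  ⟨0, Pi.single n 1, 0⟩

/-- The central elements. -/
def z (M : Fin D → Fin D → ZMod 2) (c : Fin D → ZMod 2) : ShiftGroup M := ⟨0, 0, c⟩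

theorem z_add (c c' : Fin D → ZMod 2) : z M (c + c') = z M c * z M c' := by
  rw [mul_def]
  exact ShiftGroup.ext (by simp [z]) (by funext u; simp [z])
    (by simp [z, form_zero_left])

theorem z_zero : z M 0 = 1 := rfl

theorem z_injective : Function.Injective (z M) := fun _ _ h => congrArg central h

theorem z_nsmul (n : ℕ) (c : Fin D → ZMod 2) : z M (n • c) = z M c ^ n := by
  induction n with
  | zero => simp [z_zero]
  | succ n ih => rw [succ_nsmul, z_add, ih, pow_succ]

theorem z_sum (l : List (Fin D → ZMod 2)) : z M l.sum = (l.map (z M)).prod := by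
  induction l with
  | nil => exact z_zero
  | cons c l ih => simp [z_add, ih]

theorem t_pow (n : ℕ) : t M ^ n = ⟨(n : ZMod (shiftModulus D)), 0, 0⟩ := by
  induction n with
  | zero => simp [one_def]
  | succ n ih =>
    rw [pow_succ, ih, mul_def]
    refine ShiftGroup.ext (by simp [t]) (by funext u; simp [t]) ?_
    simp [t, form_zero_left]

theorem t_inv_pow (n : ℕ) : (t M)⁻¹ ^ n = ⟨-(n : ZMod (shiftModulus D)), 0, 0⟩ := by
  rw [inv_pow, t_pow, inv_def]
  exact ShiftGroup.ext rfl rfl (by simp [form_zero_left])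

theorem conj_x (n : ZMod (shiftModulus D)) :
    (⟨n, 0, 0⟩ : ShiftGroup M) * x M 0 * (⟨n, 0, 0⟩ : ShiftGroup M)⁻¹ = x M n := by
  rw [mul_inv_eq_iff_eq_mul]
  simp only [mul_def, x]
  refine ShiftGroup.ext (by simp) ?_ ?_
  · funext u
    simp [Pi.single_apply, sub_eq_zero]
  · have h : (fun _ : ZMod (shiftModulus D) => (0 : ZMod 2)) = 0 := rfl
    simp [form_zero_left, h, form_zero_right]

theorem commutator_x (n : ZMod (shiftModulus D)) :
    x M n * x M 0 * (x M n)⁻¹ * (x M 0)⁻¹ = z M (shiftForm M (-n) + shiftForm M n) := by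
  rw [mul_inv_eq_iff_eq_mul, mul_inv_eq_iff_eq_mul, mul_assoc]
  simp only [mul_def, x, z]
  refine ShiftGroup.ext (by simp) ?_ ?_
  · funext u
    simp [add_comm]
  · simp only [sub_zero, zero_add, add_zero]
    rw [form_single, zero_sub]
    have h : form M (Pi.single 0 1) (Pi.single n 1) = shiftForm M n := by
      rw [form_single, sub_zero]
    funext i
    simp [form_zero_left, h]
    grind

theorem shiftForm_add_neg (n : ℕ) (h1 : 1 ≤ n) (h2 : n ≤ 2 * D) :
    shiftForm M (-((2 * n : ℕ) : ZMod (shiftModulus D))) +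
      shiftForm M ((2 * n : ℕ) : ZMod (shiftModulus D)) = commValue M n := by
  have hv : ((2 * n : ℕ) : ZMod (shiftModulus D)).val = 2 * n :=
    ZMod.val_cast_of_lt (by unfold shiftModulus; omega)
  have hne : ((2 * n : ℕ) : ZMod (shiftModulus D)) ≠ 0 := by
    intro h
    rw [h, ZMod.val_zero] at hv
    omega
  have hv' : (-((2 * n : ℕ) : ZMod (shiftModulus D))).val = shiftModulus D - 2 * n := by
    have : NeZero ((2 * n : ℕ) : ZMod (shiftModulus D)) := ⟨hne⟩
    rw [ZMod.val_neg_of_ne_zero, hv]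
  unfold shiftForm
  rw [hv, hv', if_neg (by unfold shiftModulus; omega), if_pos (by omega), zero_add]
  simp

theorem commWord_t (n : ℕ) (h1 : 1 ≤ n) (h2 : n ≤ 2 * D) :
    commWord (t M) (x M 0) n = z M (commValue M n) := by
  rw [commWord, t_pow, conj_x, commutator_x, shiftForm_add_neg n h1 h2]

theorem commWord_t_inv (n : ℕ) (h1 : 1 ≤ n) (h2 : n ≤ 2 * D) :
    commWord (t M)⁻¹ (x M 0) n = z M (commValue M n) := by
  rw [commWord, t_inv_pow, conj_x, commutator_x, neg_neg, add_comm, shiftForm_add_neg n h1 h2]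

theorem x_sq : x M 0 ^ 2 = 1 := by
  rw [pow_two, mul_def, one_def]
  refine ShiftGroup.ext (by simp [x]) ?_ ?_
  · simp only [x, sub_zero]
    exact funext fun _ => CharTwo.add_self_eq_zero _
  · simp only [x, sub_zero]
    rw [form_single]
    funext i
    simp [shiftForm, commValue]

theorem commValue_right (k i : Fin D) : commValue M (D + k + 1) i = M k i := by
  have h1 : ¬ (D + k + 1 = (i : ℕ) + 1) := by omega
  have h2 : D < D + k + 1 ∧ D + k + 1 ≤ 2 * D := by omega
  simp only [commValue, h1, if_false, dif_pos h2]
  exact congrArg (M · i) (Fin.ext (by simp; omega))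

theorem commValue_left (i : Fin D) : commValue M (i + 1) = Pi.single i 1 := by
  funext j
  have h : ¬ (D < (i : ℕ) + 1 ∧ (i : ℕ) + 1 ≤ 2 * D) := by omega
  simp only [commValue, dif_neg h, Pi.single_apply, Fin.ext_iff, add_left_inj, eq_comm]

/-- The group defined by `M` satisfies the relation of `M'` only if `M' = M`. -/
theorem matrixRelation_iff {T : ShiftGroup M} (M' : Fin D → Fin D → ZMod 2)
    (hT : ∀ n, 1 ≤ n → n ≤ 2 * D → commWord T (x M 0) n = z M (commValue M n)) :
    MatrixRelation M' T (x M 0) ↔ M' = M := by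
  have key (k : Fin D) : commWord T (x M 0) (D + k + 1) = ((List.finRange D).map fun i : Fin D =>
      commWord T (x M 0) (i + 1) ^ (M' k i).val).prod ↔ M k = M' k := by
    have h1 : ((List.finRange D).map fun i : Fin D =>
        commWord T (x M 0) (i + 1) ^ (M' k i).val).prod = z M (M' k) := by
      have h2 : M' k = ((List.finRange D).map
          fun i : Fin D => (M' k i).val • (Pi.single i 1 : Fin D → ZMod 2)).sum := by
        rw [← List.ofFn_eq_map, List.sum_ofFn]
        funext j
        simp only [Finset.sum_apply, Pi.smul_apply]
        simp [Pi.single_apply]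
      conv_rhs => rw [h2]
      rw [z_sum, List.map_map]
      congr 1
      refine List.map_congr_left fun i _ => ?_
      rw [hT _ (by omega) (by omega), commValue_left, Function.comp_apply, z_nsmul]
    rw [h1, hT _ (by omega) (by omega), z_injective.eq_iff,
      show commValue M (D + k + 1) = M k from funext (commValue_right k)]
  unfold MatrixRelation
  rw [funext_iff]
  exact forall_congr' fun k => (key k).trans eq_comm

theorem matrixRelation_of_isCoordinate {T X : ShiftGroup M}
    (h : IsCoordinate (t M) (x M 0) T X) : MatrixRelation M T X := by
  rcases h with h | h | ⟨rfl, rfl⟩ | ⟨rfl, rfl⟩ | h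
  · exact matrixRelation_of_commWord_eq_one M (commWord_eq_one (Or.inl h))
  · exact matrixRelation_of_commWord_eq_one M (commWord_eq_one (Or.inr (Or.inl h)))
  · exact (matrixRelation_iff M commWord_t).2 rfl
  · exact (matrixRelation_iff M commWord_t_inv).2 rfl
  · exact matrixRelation_of_commWord_eq_one M (commWord_eq_one (Or.inr (Or.inr h)))

/-- The underlying type of `ShiftGroup M` as a product. -/
def equivProd (M : Fin D → Fin D → ZMod 2) : ShiftGroup M ≃
    ZMod (shiftModulus D) × (ZMod (shiftModulus D) → ZMod 2) × (Fin D → ZMod 2) where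
  toFun p := (p.shift, p.coord, p.central)
  invFun p := ⟨p.1, p.2.1, p.2.2⟩
  left_inv _ := rfl
  right_inv _ := rfl

instance : Finite (ShiftGroup M) := Finite.of_equiv _ (equivProd M).symm

theorem card_le (hD : 1 ≤ D) : Nat.card (ShiftGroup M) ≤ 2 ^ (18 * D) := by
  rw [Nat.card_congr (equivProd M)]
  rw [Nat.card_prod, Nat.card_prod, Nat.card_fun, Nat.card_fun, Nat.card_zmod, Nat.card_zmod,
    Nat.card_eq_fintype_card (α := Fin D), Fintype.card_fin]
  have h : shiftModulus D ≤ 2 ^ (8 * D) := Nat.succ_le_of_lt Nat.lt_two_pow_self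
  calc shiftModulus D * (2 ^ shiftModulus D * 2 ^ D)
      ≤ 2 ^ (8 * D) * (2 ^ shiftModulus D * 2 ^ D) := Nat.mul_le_mul_right _ h
    _ = 2 ^ (8 * D + (shiftModulus D + D)) := by rw [← pow_add, ← pow_add]
    _ ≤ 2 ^ (18 * D) := Nat.pow_le_pow_right (by norm_num) (by unfold shiftModulus; omega)

end ShiftGroup

end HeisenbergShift

section TutteCoxeter

/-- The sequence of numbers below `30` encoded in base `32` by `N`. -/
def decodeTable (N : ℕ) (i : Fin 30) : Fin 30 := Fin.ofNat 30 (N / 32 ^ (i : ℕ) % 32)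

/-- The Tutte–Coxeter graph: a Hamiltonian cycle together with a perfect matching. -/
def tutteCoxeter : SimpleGraph (Fin 30) where
  Adj i j := j = i + 1 ∨ i = j + 1 ∨
    j = decodeTable 545850362474185412080785404524299843949897425 i
  symm := ⟨by decide +kernel⟩
  loopless := ⟨by decide +kernel⟩

instance : DecidableRel tutteCoxeter.Adj := fun i j =>
  inferInstanceAs (Decidable (j = i + 1 ∨ i = j + 1 ∨
    j = decodeTable 545850362474185412080785404524299843949897425 i))

theorem dValent_tutteCoxeter : DValent tutteCoxeter 3 := by
  intro v
  have h : tutteCoxeter.neighborSet v = (tutteCoxeter.neighborFinset v : Set (Fin 30)) := by simp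
  have h' : ∀ v, tutteCoxeter.degree v = 3 := by decide +kernel
  rw [h, Set.ncard_coe_finset, SimpleGraph.card_neighborFinset_eq_degree, h']

theorem reachable_tutteCoxeter (i : Fin 30) : tutteCoxeter.Reachable 0 i := by
  have h : ∀ i : Fin 29, tutteCoxeter.Adj i.castSucc i.succ := by decide +kernel
  induction i using Fin.induction with
  | zero => rfl
  | succ i ih => exact ih.trans (h i).reachable

/-- The table `N` encodes an automorphism of order at most two of the Tutte–Coxeter graph. -/
def IsAutTable (N : ℕ) : Prop :=
  (∀ i, decodeTable N (decodeTable N i) = i) ∧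
    ∀ i j, tutteCoxeter.Adj i j → tutteCoxeter.Adj (decodeTable N i) (decodeTable N j)

instance (N : ℕ) : Decidable (IsAutTable N) := inferInstanceAs (Decidable (_ ∧ _))

theorem IsAutTable.exists_iso {N : ℕ} (h : IsAutTable N) :
    ∃ φ : tutteCoxeter ≃g tutteCoxeter, ∀ i, φ i = decodeTable N i :=
  ⟨⟨⟨decodeTable N, decodeTable N, h.1, h.1⟩, fun {i j} =>
    ⟨fun hij => by simpa [h.1] using h.2 _ _ hij, h.2 i j⟩⟩, fun _ => rfl⟩

theorem exists_fix_zero_map_one {w : Fin 30} (hw : tutteCoxeter.Adj 0 w) :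
    ∃ ψ : tutteCoxeter ≃g tutteCoxeter, ψ 0 = 0 ∧ ψ 1 = w := by
  have hw' : w = 1 ∨ w = 17 ∨ w = 29 := by revert w; decide +kernel
  rcases hw' with rfl | rfl | rfl
  · exact ⟨RelIso.refl _, rfl, rfl⟩
  · obtain ⟨φ, hφ⟩ := IsAutTable.exists_iso
      (N := 1333681063993097006081862206679533145880838688) (by decide +kernel)
    exact ⟨φ, (hφ _).trans (by decide +kernel), (hφ _).trans (by decide +kernel)⟩
  · obtain ⟨φ, hφ⟩ := IsAutTable.exists_iso
      (N := 47556237098835167326287436425438929821234080) (by decide +kernel)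
    exact ⟨φ, (hφ _).trans (by decide +kernel), (hφ _).trans (by decide +kernel)⟩

theorem exists_map_zero (u : Fin 30) : ∃ φ : tutteCoxeter ≃g tutteCoxeter, φ 0 = u := by
  obtain ⟨σ, hσ⟩ := IsAutTable.exists_iso
    (N := 94554457463276268962901187919057101971682305) (by decide +kernel)
  have hσ0 : σ 0 = 1 := (hσ 0).trans (by decide +kernel)
  obtain ⟨p⟩ := reachable_tutteCoxeter u
  suffices h : ∀ v w : Fin 30, tutteCoxeter.Walk v w →
      (∃ φ : tutteCoxeter ≃g tutteCoxeter, φ 0 = v) →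
      ∃ φ : tutteCoxeter ≃g tutteCoxeter, φ 0 = w from h _ _ p ⟨RelIso.refl _, rfl⟩
  intro v w q
  induction q with
  | nil => exact id
  | @cons a b c hab q ih =>
    rintro ⟨φ, hφ⟩
    refine ih ?_
    have h0 : tutteCoxeter.Adj 0 (φ.symm b) := by
      rw [← φ.map_adj_iff, hφ, RelIso.apply_symm_apply]
      exact hab
    obtain ⟨ψ, -, hψ⟩ := exists_fix_zero_map_one h0
    refine ⟨(σ.trans ψ).trans φ, ?_⟩
    simp [hσ0, hψ]

theorem isSArcTransitive_one_tutteCoxeter : IsSArcTransitive tutteCoxeter 1 := by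
  have key (f : ℕ → Fin 30) (hf : IsArcSeq tutteCoxeter 1 f) :
      ∃ φ : tutteCoxeter ≃g tutteCoxeter, φ 0 = f 0 ∧ φ 1 = f 1 := by
    obtain ⟨φ, hφ⟩ := exists_map_zero (f 0)
    have h0 : tutteCoxeter.Adj 0 (φ.symm (f 1)) := by
      rw [← φ.map_adj_iff, hφ, RelIso.apply_symm_apply]
      exact hf.1 0 one_pos
    obtain ⟨ψ, hψ0, hψ1⟩ := exists_fix_zero_map_one h0
    exact ⟨ψ.trans φ, by simp [hψ0, hφ], by simp [hψ1]⟩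
  rw [isSArcTransitive_iff]
  intro f g hf hg
  obtain ⟨φ, hφ0, hφ1⟩ := key f hf
  obtain ⟨ψ, hψ0, hψ1⟩ := key g hg
  refine ⟨φ.symm.trans ψ, fun i hi => ?_⟩
  have hi' : i = 0 ∨ i = 1 := by omega
  rcases hi' with rfl | rfl
  · rw [← hφ0, ← hψ0]; simp
  · rw [← hφ1, ← hψ1]; simp

theorem isSArcTransitive_succ_of_table {s : ℕ} (hs : 1 ≤ s) (hs' : s + 1 < 30)
    (hT : IsSArcTransitive tutteCoxeter s) (N : ℕ) (hN : IsAutTable N)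
    (hfix : ∀ i ≤ s, decodeTable N (Fin.ofNat 30 i) = Fin.ofNat 30 i)
    (hmove : decodeTable N (Fin.ofNat 30 (s + 1)) ≠ Fin.ofNat 30 (s + 1)) :
    IsSArcTransitive tutteCoxeter (s + 1) := by
  obtain ⟨φ, hφ⟩ := hN.exists_iso
  have hadj : ∀ i < 29, tutteCoxeter.Adj (Fin.ofNat 30 i) (Fin.ofNat 30 (i + 1)) := by
    decide +kernel
  have hne : ∀ i < 28, Fin.ofNat 30 i ≠ Fin.ofNat 30 (i + 2) := by decide +kernel
  refine hT.succ_of_fix dValent_tutteCoxeter hs (f := fun i => Fin.ofNat 30 i)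
    ⟨fun i hi => hadj i (by omega), fun i hi => hne i (by omega)⟩ φ
    (fun i hi => (hφ _).trans (hfix i hi)) (hadj s (by omega)) ?_
  rw [hφ]
  exact hmove

theorem isSArcTransitive_five_tutteCoxeter : IsSArcTransitive tutteCoxeter 5 := by
  have h2 := isSArcTransitive_succ_of_table le_rfl (by norm_num)
    isSArcTransitive_one_tutteCoxeter 1310754715124608575096425905035698908485572640
    (by decide +kernel) (by decide +kernel) (by decide +kernel)
  have h3 := isSArcTransitive_succ_of_table (by norm_num) (by norm_num) h2
    1310662344937984911638137283676810398004447264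
    (by decide +kernel) (by decide +kernel) (by decide +kernel)
  have h4 := isSArcTransitive_succ_of_table (by norm_num) (by norm_num) h3
    1310740676426759064182401457243871835597146144
    (by decide +kernel) (by decide +kernel) (by decide +kernel)
  exact isSArcTransitive_succ_of_table (by norm_num) (by norm_num) h4
    781651550828254235680809949525197617918740512
    (by decide +kernel) (by decide +kernel) (by decide +kernel)

/-- The arcs between consecutive vertices of a list. -/
def arcsOfList (l : List (Fin 30)) : List (Fin 30 × Fin 30) := l.zip l.tail

/-- An 8-cycle in the Tutte–Coxeter graph. -/
def firstCycle : List (Fin 30 × Fin 30) := arcsOfList [0, 1, 2, 3, 4, 5, 18, 17, 0]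

/-- An edge to a second 8-cycle. -/
def connectingPath : List (Fin 30 × Fin 30) := [(0, 29)]

/-- An 8-cycle in the Tutte–Coxeter graph, disjoint from `firstCycle`. -/
def secondCycle : List (Fin 30 × Fin 30) := arcsOfList [29, 12, 11, 10, 9, 8, 7, 28, 29]

/-- The closed walk at `0` around `secondCycle`. -/
def lollipop : List (Fin 30 × Fin 30) :=
  connectingPath ++ (secondCycle ++ arcReverse connectingPath)

/-- A closed non-backtracking walk with the voltage of a commutator. -/
def commutatorWalk : List (Fin 30 × Fin 30) :=
  firstCycle ++ (firstCycle ++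
    ((connectingPath ++ (secondCycle ++ (secondCycle ++ arcReverse connectingPath))) ++
    (arcReverse firstCycle ++ (arcReverse firstCycle ++
    (connectingPath ++ (arcReverse secondCycle ++ (arcReverse secondCycle ++
      arcReverse connectingPath)))))))

instance (a : Fin 30 × Fin 30) (l : List (Fin 30 × Fin 30)) : Decidable (Touches a l) :=
  inferInstanceAs (Decidable (_ ∨ _))

instance (v : Fin 30) (l : List (Fin 30 × Fin 30)) :
    Decidable (IsClosedArcList tutteCoxeter v l) :=
  inferInstanceAs (Decidable (_ ∧ ∀ k < l.length, _ ∧ _))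

theorem isClosedArcList_firstCycle : IsClosedArcList tutteCoxeter 0 firstCycle := by
  decide +kernel

theorem isClosedArcList_lollipop : IsClosedArcList tutteCoxeter 0 lollipop := by
  decide +kernel

theorem isClosedArcList_commutatorWalk : IsClosedArcList tutteCoxeter 0 commutatorWalk := by
  decide +kernel

theorem length_commutatorWalk : commutatorWalk.length = 68 := by decide +kernel

theorem commutatorWalk_nonbacktracking (k : ℕ) (hk : k + 2 ≤ commutatorWalk.length) :
    arcStart 0 commutatorWalk k ≠ arcStart 0 commutatorWalk (k + 2) := by
  have h : ∀ k < 67, arcStart 0 commutatorWalk k ≠ arcStart 0 commutatorWalk (k + 2) := by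
    decide +kernel
  rw [length_commutatorWalk] at hk
  exact h k (by omega)

theorem not_touches_firstCycle_lollipop :
    ∀ a, ¬ (Touches a firstCycle ∧ Touches a lollipop) := by
  decide +kernel

theorem arcExponent_firstCycle : ∀ a, arcExponent a firstCycle = 0 ∨
    arcExponent a firstCycle = 1 ∨ arcExponent a firstCycle = -1 := by
  decide +kernel

theorem arcProd_symVoltage_firstCycle {K : Type*} [Group K] (t x : K) :
    arcProd (symVoltage t x) firstCycle ((0, 1), (29, 12)) = t := by
  rw [arcProd_symVoltage, arcProd_pairVoltage_left _ _ _ _ _ (by decide +kernel)]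
  have h : arcExponent (0, 1) firstCycle = 1 := by decide +kernel
  simp only [h, zpow_one]

theorem arcProd_symVoltage_lollipop {K : Type*} [Group K] (t x : K) :
    arcProd (symVoltage t x) lollipop ((0, 1), (29, 12)) = x := by
  rw [arcProd_symVoltage, arcProd_pairVoltage_right _ _ _ _ _ (by decide +kernel)]
  have h : arcExponent (29, 12) lollipop = 1 := by decide +kernel
  simp only [h, zpow_one]

theorem arcProd_symVoltage_commutatorWalk {K : Type*} [Group K] (t x : K) (hx : x ^ 2 = 1) :
    arcProd (symVoltage t x) commutatorWalk = 1 := by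
  obtain ⟨A, hA⟩ : ∃ A, arcProd (symVoltage t x) firstCycle = A := ⟨_, rfl⟩
  obtain ⟨P, hP⟩ : ∃ P, arcProd (symVoltage t x) connectingPath = P := ⟨_, rfl⟩
  obtain ⟨C, hC⟩ : ∃ C, arcProd (symVoltage t x) secondCycle = C := ⟨_, rfl⟩
  have hX : arcProd (symVoltage t x) lollipop = P * (C * P⁻¹) := by
    rw [lollipop, arcProd_append, arcProd_append, arcProd_arcReverse (symVoltage_swap t x), hP, hC]
  have h : arcProd (symVoltage t x) commutatorWalk =
      A ^ 2 * (P * (C * P⁻¹)) ^ 2 * (A ^ 2)⁻¹ * ((P * (C * P⁻¹)) ^ 2)⁻¹ := by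
    simp only [commutatorWalk, arcProd_append, arcProd_arcReverse (symVoltage_swap t x), hA, hP, hC]
    simp only [pow_two, mul_inv_rev, inv_inv, mul_assoc, inv_mul_cancel_left]
  rw [h, ← hA, ← hX]
  funext i
  have hi := isCoordinate_arcProd t x hx not_touches_firstCycle_lollipop arcExponent_firstCycle i
  simp only [Pi.mul_apply, Pi.pow_apply, Pi.inv_apply, Pi.one_apply]
  rcases hi with h | h | ⟨-, h⟩ | ⟨-, h⟩ | h
  · simp [h]
  · simp [h]
  · simp [h, hx]
  · simp [h, hx]
  · simp [h]

end TutteCoxeter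

section Counting

variable {V V' : Type*} {Γ : SimpleGraph V} {Γ' : SimpleGraph V'}

theorem DValent.of_iso (e : Γ ≃g Γ') {d : ℕ} (h : DValent Γ d) : DValent Γ' d := by
  intro v
  rw [← h (e.symm v), ← Set.ncard_image_of_injective _ e.injective]
  congr 1
  ext w
  simp only [Set.mem_image, SimpleGraph.mem_neighborSet]
  constructor
  · intro hw
    exact ⟨e.symm w, e.symm.map_adj_iff.2 hw, e.apply_symm_apply w⟩
  · rintro ⟨u, hu, rfl⟩
    simpa using e.map_adj_iff.2 hu

theorem IsSArcTransitive.of_iso (e : Γ ≃g Γ') {s : ℕ} (h : IsSArcTransitive Γ s) :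
    IsSArcTransitive Γ' s := by
  rw [isSArcTransitive_iff] at h ⊢
  have key (f : ℕ → V') (hf : IsArcSeq Γ' s f) : IsArcSeq Γ s (fun i => e.symm (f i)) :=
    ⟨fun i hi => e.symm.map_adj_iff.2 (hf.1 i hi),
      fun i hi heq => hf.2 i hi (e.symm.injective heq)⟩
  intro f g hf hg
  obtain ⟨φ, hφ⟩ := h _ _ (key f hf) (key g hg)
  refine ⟨(e.symm.trans φ).trans e, fun i hi => ?_⟩
  simp [hφ i hi]

/-- Conjugation of automorphisms by an isomorphism. -/
def conjAut (e : Γ ≃g Γ') : (Γ ≃g Γ) →* (Γ' ≃g Γ') where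
  toFun φ := (e.symm.trans φ).trans e
  map_one' := by ext; simp
  map_mul' φ ψ := by ext; simp

theorem conjAut_injective (e : Γ ≃g Γ') : Function.Injective (conjAut e) := by
  intro φ ψ h
  ext v
  have h' := congrArg (fun σ : Γ' ≃g Γ' => σ (e v)) h
  simpa [conjAut] using h'

/-- The number of coordinates of the voltages. -/
noncomputable def coordCount : ℕ := Nat.card ((Fin 30 × Fin 30) × (Fin 30 × Fin 30))

/-- The growth exponent of the number of vertices of the covers. -/
noncomputable def coverExponent : ℕ := 5 + 18 * coordCount

theorem exists_cover {D : ℕ} (hD : 1 ≤ D) (M : Fin D → Fin D → ZMod 2) :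
    ∃ x : GSig, x.1 ≤ 2 ^ (coverExponent * D) ∧ x.2.Connected ∧ DValent x.2 3 ∧
      IsSArcTransitive x.2 5 ∧ Nat.card (x.2 ≃g x.2) ≤ x.1 ^ 68 ∧
      ∃ A B : x.2 ≃g x.2, ∀ M', MatrixRelation M' A B ↔ M' = M := by
  let t := ShiftGroup.t M
  let x := ShiftGroup.x M 0
  have hx : x ^ 2 = 1 := ShiftGroup.x_sq
  have hζ : ∀ u v : Fin 30, tutteCoxeter.Adj u v → symVoltage t x v u = (symVoltage t x u v)⁻¹ :=
    fun u v _ => symVoltage_swap t x u v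
  obtain ⟨C, hC⟩ : ∃ C, C = (voltageCover tutteCoxeter _ hζ).connectedComponentMk (0, 1) := ⟨_, rfl⟩
  let Y := C.toSimpleGraph
  have hYc : Y.Connected := C.connected_toSimpleGraph
  have hY3 : DValent Y 3 := (dValent_voltageCover dValent_tutteCoxeter).toSimpleGraph C
  have hY5 : IsSArcTransitive Y 5 :=
    isSArcTransitive_voltageCover isSArcTransitive_five_tutteCoxeter
      (fun φ => (exists_symVoltage_equiv t x φ.toEquiv).imp fun θ hθ u v _ => hθ u v) C
  have hcard : Nat.card C ≤ 2 ^ (coverExponent * D) := by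
    refine (Nat.card_le_card_of_injective _ Subtype.val_injective).trans ?_
    rw [Nat.card_prod, Nat.card_fun, Nat.card_eq_fintype_card (α := Fin 30), Fintype.card_fin,
      coverExponent, add_mul, pow_add]
    refine Nat.mul_le_mul ?_ ?_
    · calc 30 ≤ 2 ^ (5 * 1) := by norm_num
        _ ≤ 2 ^ (5 * D) := Nat.pow_le_pow_right (by norm_num) (by omega)
    · rw [mul_right_comm, pow_mul]
      exact Nat.pow_le_pow_left (ShiftGroup.card_le hD) _
  have hclosed : ∃ h : ℕ → C, IsArcSeq Y 68 h ∧ h 0 = h 68 := by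
    subst hC
    have h := exists_closed_arc (hζ := hζ) isClosedArcList_commutatorWalk
      commutatorWalk_nonbacktracking (arcProd_symVoltage_commutatorWalk t x hx)
    rwa [length_commutatorWalk] at h
  obtain ⟨h, hh, hcl⟩ := hclosed
  have haut : Nat.card (Y ≃g Y) ≤ Nat.card C ^ 68 :=
    card_aut_le hY3 hYc (s := 5) (by norm_num) (by norm_num) hY5 hh hcl
  have hAB : ∃ A B : Y ≃g Y, ∀ M', MatrixRelation M' A B ↔ M' = M := by
    subst hC
    let A : componentVoltages hζ 0 :=
      ⟨arcProd (symVoltage t x) firstCycle, deck_mem_componentStabilizer isClosedArcList_firstCycle⟩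
    let B : componentVoltages hζ 0 :=
      ⟨arcProd (symVoltage t x) lollipop, deck_mem_componentStabilizer isClosedArcList_lollipop⟩
    refine ⟨componentDeck hζ 0 A, componentDeck hζ 0 B, fun M' => ?_⟩
    rw [matrixRelation_map_iff _ (componentDeck_injective 0),
      ← matrixRelation_map_iff (componentVoltages hζ 0).subtype (Subgroup.subtype_injective _)]
    change MatrixRelation M' (arcProd (symVoltage t x) firstCycle)
      (arcProd (symVoltage t x) lollipop) ↔ _
    rw [matrixRelation_pi_iff]
    constructor
    · intro h
      have h1 := h ((0, 1), (29, 12))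
      rw [arcProd_symVoltage_firstCycle, arcProd_symVoltage_lollipop] at h1
      exact (ShiftGroup.matrixRelation_iff M' ShiftGroup.commWord_t).1 h1
    · rintro rfl i
      exact ShiftGroup.matrixRelation_of_isCoordinate
        (isCoordinate_arcProd t x hx not_touches_firstCycle_lollipop arcExponent_firstCycle i)
  obtain ⟨A, B, hAB⟩ := hAB
  have := Fintype.ofFinite C
  have e := Y.overFinIso (Nat.card_eq_fintype_card (α := C)).symm
  refine ⟨⟨Nat.card C, Y.overFin (Nat.card_eq_fintype_card (α := C)).symm⟩, hcard,
    e.connected_iff.1 hYc, hY3.of_iso e, hY5.of_iso e, ?_, conjAut e A, conjAut e B, fun M' => ?_⟩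
  · have : Finite (Y ≃g Y) := DFunLike.finite _
    exact (Nat.card_le_card_of_injective _ (conjAut_injective e.symm)).trans haut
  · rw [matrixRelation_map_iff _ (conjAut_injective e), hAB]

theorem two_pow_le_fiveArcCount {D n : ℕ} (hD : 1 ≤ D) (hn : 2 ^ (coverExponent * D) ≤ n) :
    2 ^ (D * D) ≤ 2 ^ (136 * coverExponent * D) * fiveArcCount n := by
  classical
  choose x hxn hxc hx3 hx5 hxa A B hAB using exists_cover hD
  let P : GSig → Prop :=
    fun x => x.1 ≤ n ∧ x.2.Connected ∧ DValent x.2 3 ∧ IsSArcTransitive x.2 5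
  have hP (M) : P (x M) := ⟨(hxn M).trans hn, hxc M, hx3 M, hx5 M⟩
  have hfin : Finite {x : GSig // P x} := by
    let F : {x : GSig // P x} → Σ m : Fin (n + 1), SimpleGraph (Fin m) :=
      fun y => ⟨⟨y.1.1, Nat.lt_succ_of_le y.2.1⟩, y.1.2⟩
    refine Finite.of_injective F ?_
    rintro ⟨⟨m, Γ⟩, h⟩ ⟨⟨m', Γ'⟩, h'⟩ heq
    simp only [F, Sigma.mk.injEq, Fin.mk.injEq] at heq
    obtain ⟨rfl, heq⟩ := heq
    obtain rfl := eq_of_heq heq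
    rfl
  have hfinq : Finite (Quotient (graphSetoid P)) := Quotient.finite _
  let q : (Fin D → Fin D → ZMod 2) → Quotient (graphSetoid P) := fun M => ⟦⟨x M, hP M⟩⟧
  have hfibre (M₀ : Fin D → Fin D → ZMod 2) :
      ({M | q M = q M₀} : Finset _).card ≤ 2 ^ (136 * coverExponent * D) := by
    have hiso (M : {M // q M = q M₀}) : Nonempty ((x M.1).2 ≃g (x M₀).2) := Quotient.exact M.2
    let e (M : {M // q M = q M₀}) := (hiso M).some
    let F : {M // q M = q M₀} → ((x M₀).2 ≃g (x M₀).2) × ((x M₀).2 ≃g (x M₀).2) :=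
      fun M => (conjAut (e M) (A M.1), conjAut (e M) (B M.1))
    have hF : Function.Injective F := by
      intro M M' h
      obtain ⟨h1, h2⟩ := Prod.ext_iff.1 h
      simp only [F] at h1 h2
      refine Subtype.ext ((hAB M'.1 M.1).1 ?_)
      rw [← matrixRelation_map_iff _ (conjAut_injective (e M')), ← h1, ← h2,
        matrixRelation_map_iff _ (conjAut_injective (e M)), hAB]
    have : Finite ((x M₀).2 ≃g (x M₀).2) := DFunLike.finite _
    have h1 := Nat.card_le_card_of_injective F hF
    rw [Nat.card_eq_fintype_card, Fintype.card_subtype, Nat.card_prod] at h1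
    refine h1.trans ?_
    have h2 : Nat.card ((x M₀).2 ≃g (x M₀).2) ≤ (2 ^ (coverExponent * D)) ^ 68 :=
      (hxa M₀).trans (Nat.pow_le_pow_left (hxn M₀) _)
    refine (Nat.mul_le_mul h2 h2).trans (le_of_eq ?_)
    rw [← pow_mul, ← pow_add]
    congr 1
    ring
  have := Fintype.ofFinite (Quotient (graphSetoid P))
  have h := Finset.card_le_mul_card_image (f := q) Finset.univ (2 ^ (136 * coverExponent * D))
    (by
      intro a ha
      obtain ⟨M₀, -, rfl⟩ := Finset.mem_image.1 ha
      exact hfibre M₀)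
  have hcard : (Finset.univ : Finset (Fin D → Fin D → ZMod 2)).card = 2 ^ (D * D) := by
    rw [Finset.card_univ, Fintype.card_fun, Fintype.card_fun, ZMod.card, Fintype.card_fin, pow_mul]
  have hle : (Finset.univ.image q).card ≤ fiveArcCount n := by
    change _ ≤ Nat.card (Quotient (graphSetoid P))
    rw [Nat.card_eq_fintype_card]
    exact Finset.card_le_univ _
  rw [hcard] at h
  exact h.trans (Nat.mul_le_mul_left _ hle)

end Counting

/-- There exist positive constants `a`, `b` such that for every `n ≥ 1`, the number of
isomorphism classes of connected 3-valent 5-arc-transitive graphs of order at most `n`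
is at least `n^(a·log n) − b`. -/
theorem five_arc_transitive_lower_bound :
    ∃ a b : ℝ, 0 < a ∧ 0 < b ∧ ∀ n : ℕ, 1 ≤ n →
      (n : ℝ) ^ (a * Real.log n) - b ≤ fiveArcCount n := by
  obtain ⟨c, hc⟩ : ∃ c, c = coverExponent := ⟨_, rfl⟩
  have hc1 : 1 ≤ c := by rw [hc, coverExponent]; omega
  have hcR : (1 : ℝ) ≤ c := by exact_mod_cast hc1
  have hl : 0 < Real.log 2 := Real.log_pos (by norm_num)
  obtain ⟨l, hll⟩ : ∃ l, l = Real.log 2 := ⟨_, rfl⟩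
  rw [← hll] at hl
  obtain ⟨a, ha⟩ : ∃ a : ℝ, a = 1 / (8 * c ^ 2 * l) := ⟨_, rfl⟩
  have ha0 : 0 < a := by rw [ha]; positivity
  refine ⟨a, Real.exp (a * (c * (272 * c) * l) ^ 2), ha0, Real.exp_pos _, fun n hn => ?_⟩
  have hn0 : (0 : ℝ) < n := by exact_mod_cast hn
  have hL0 : 0 ≤ Real.log n := Real.log_nonneg (by exact_mod_cast hn)
  obtain ⟨D, hD⟩ : ∃ D, D = Nat.log 2 n / c := ⟨_, rfl⟩
  have hlow : 2 ^ (c * D) ≤ n :=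
    (Nat.pow_le_pow_right (by norm_num) (hD ▸ Nat.mul_div_le _ _)).trans
      (Nat.pow_log_le_self 2 (by omega))
  have hup : n < 2 ^ (c * (D + 1)) := by
    refine (Nat.lt_pow_succ_log_self (by norm_num) n).trans_le
      (Nat.pow_le_pow_right (by norm_num) ?_)
    rw [hD]
    exact Nat.lt_mul_div_succ _ hc1
  have hLup : Real.log n ≤ c * (D + 1) * l := by
    have h1 : (n : ℝ) ≤ 2 ^ (c * (D + 1)) := by exact_mod_cast hup.le
    have h2 := Real.log_le_log hn0 h1
    rw [Real.log_pow, ← hll] at h2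
    push_cast at h2
    exact h2
  have hpow : (n : ℝ) ^ (a * Real.log n) = Real.exp (a * Real.log n ^ 2) := by
    rw [Real.rpow_def_of_pos hn0]
    congr 1
    ring
  rw [hpow]
  by_cases hlarge : 272 * c ≤ D
  · have hD1 : 1 ≤ D := by omega
    have hDR : (1 : ℝ) ≤ D := by exact_mod_cast hD1
    have hlargeR : 272 * (c : ℝ) ≤ D := by exact_mod_cast hlarge
    have hcount := two_pow_le_fiveArcCount hD1 (hc ▸ hlow)
    rw [← hc] at hcount
    have hexp (k : ℕ) : (2 : ℝ) ^ k = Real.exp (k * l) := by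
      rw [hll, mul_comm, Real.exp_mul, Real.exp_log (by norm_num), Real.rpow_natCast]
    have hcountR : Real.exp (D * D * l) ≤ Real.exp (136 * c * D * l) * fiveArcCount n := by
      have h : ((2 : ℝ) ^ (D * D)) ≤ 2 ^ (136 * c * D) * fiveArcCount n := by
        exact_mod_cast hcount
      rw [hexp, hexp] at h
      push_cast at h
      exact h
    have hcountR' : Real.exp (D * D * l - 136 * c * D * l) ≤ fiveArcCount n := by
      rw [Real.exp_sub, div_le_iff₀ (Real.exp_pos _), mul_comm (fiveArcCount n : ℝ)]
      exact hcountR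
    have hLsq : a * Real.log n ^ 2 ≤ D * D * l - 136 * c * D * l := by
      have h1 : Real.log n ≤ 2 * c * D * l := by
        refine hLup.trans (mul_le_mul_of_nonneg_right ?_ hl.le)
        nlinarith
      calc a * Real.log n ^ 2 ≤ a * (2 * c * D * l) ^ 2 := by gcongr
        _ = D * D * l / 2 := by rw [ha]; field_simp; ring
        _ ≤ D * D * l - 136 * c * D * l := by
          have h2 : 0 ≤ (D - 272 * (c : ℝ)) * (D * l) :=
            mul_nonneg (by linarith) (by positivity)
          linarith
    have h := (Real.exp_le_exp.2 hLsq).trans hcountR'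
    linarith [Real.exp_pos (a * (c * (272 * c) * l) ^ 2)]
  · have h1 : ((D : ℝ) + 1) ≤ 272 * c := by exact_mod_cast (not_le.1 hlarge)
    have h2 : a * Real.log n ^ 2 ≤ a * (c * (272 * c) * l) ^ 2 := by
      gcongr
      exact hLup.trans (by gcongr)
    have h3 := Real.exp_le_exp.2 h2
    have h4 : (0 : ℝ) ≤ fiveArcCount n := Nat.cast_nonneg _
    linarith
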